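/- Let l, m be natural numbers, let d_p : Fin l → ℝ and d_q : Fin m → ℝ have all entries positive, and set M_p = diagonal(d_p), M_q = diagonal(d_q), M_p^{±1/2} = diagonal(d_p^{±1/2}), M_q^{±1/2} = diagonal(d_q^{±1/2}). Let t_f > 0, let δe_p : ℝ → ℝ^l and δe_q : ℝ → ℝ^m be continuously differentiable with δe_p(0) = 0, δe_q(0) = 0, and let ρ_p : ℝ → ℝ^l, ρ_q : ℝ → ℝ^m be continuous such that for all t ∈ [0, t_f]: δe_p(t) · M_p δe_p′(t) + δe_q(t) · M_q δe_q′(t) = −δe_p(t) · ρ_p(t) − δe_q(t) · ρ_q(t). Let t* ∈ [0, t_f] be a point at which t ↦ ‖M_p^{1/2} δe_p(t)‖ + ‖M_q^{1/2} δe_q(t)‖ attains its maximum over [0, t_f]. Then ‖δe_p(t*)‖ + ‖δe_q(t*)‖ ≤ 4 ( max_i d_p(i)^{−1/2} + max_j d_q(j)^{−1/2} ) ∫₀^{t_f} ( ‖M_p^{−1/2} ρ_p(τ)‖ + ‖M_q^{−1/2} ρ_q(τ)‖ ) dτ. -/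

import Mathlib

open Matrix

/-- The Euclidean norm of a vector in `ℝ^n`. -/
noncomputable def euclNorm {n : ℕ} (x : Fin n → ℝ) : ℝ := Real.sqrt (x ⬝ᵥ x)

lemma euclNorm_nonneg' {n : ℕ} (x : Fin n → ℝ) : 0 ≤ euclNorm x := Real.sqrt_nonneg _

lemma dot_self_nonneg' {n : ℕ} (x : Fin n → ℝ) : 0 ≤ x ⬝ᵥ x :=
  Finset.sum_nonneg fun i _ => mul_self_nonneg (x i)

lemma euclNorm_sq' {n : ℕ} (x : Fin n → ℝ) : euclNorm x ^ 2 = x ⬝ᵥ x :=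
  Real.sq_sqrt (dot_self_nonneg' x)

lemma euclNorm_cont {n : ℕ} : Continuous (fun x : Fin n → ℝ => euclNorm x) := by
  unfold euclNorm dotProduct
  fun_prop

lemma neg_dot_le {n : ℕ} (d : Fin n → ℝ) (hd : ∀ i, 0 < d i) (x r : Fin n → ℝ) :
    -(x ⬝ᵥ r) ≤ euclNorm ((Matrix.diagonal fun i => Real.sqrt (d i)).mulVec x)
      * euclNorm ((Matrix.diagonal fun i => (Real.sqrt (d i))⁻¹).mulVec r) := by
  set u := (Matrix.diagonal fun i => Real.sqrt (d i)).mulVec x with hu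
  set v := (Matrix.diagonal fun i => (Real.sqrt (d i))⁻¹).mulVec r with hv
  have h1 : x ⬝ᵥ r = u ⬝ᵥ v := by
    unfold dotProduct
    refine Finset.sum_congr rfl fun i _ => ?_
    have : Real.sqrt (d i) ≠ 0 := (Real.sqrt_pos.2 (hd i)).ne'
    rw [hu, hv, Matrix.mulVec_diagonal, Matrix.mulVec_diagonal]
    field_simp
  rw [h1]
  have h2 : (u ⬝ᵥ v) ^ 2 ≤ (euclNorm u * euclNorm v) ^ 2 := by
    rw [mul_pow, euclNorm_sq', euclNorm_sq']
    have := Finset.sum_mul_sq_le_sq_mul_sq Finset.univ u v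
    simpa [dotProduct, pow_two] using this
  have h3 := abs_le_of_sq_le_sq h2 (mul_nonneg (euclNorm_nonneg' u) (euclNorm_nonneg' v))
  linarith [neg_abs_le (u ⬝ᵥ v)]

lemma euclNorm_le_weighted {n : ℕ} (d : Fin n → ℝ) (hd : ∀ i, 0 < d i) (x : Fin n → ℝ) :
    euclNorm x ≤ (⨆ i, (Real.sqrt (d i))⁻¹)
      * euclNorm ((Matrix.diagonal fun i => Real.sqrt (d i)).mulVec x) := by
  have hc : 0 ≤ ⨆ i, (Real.sqrt (d i))⁻¹ := Real.iSup_nonneg fun i => by positivity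
  refine (sq_le_sq₀ (euclNorm_nonneg' _) (mul_nonneg hc (euclNorm_nonneg' _))).1 ?_
  rw [mul_pow, euclNorm_sq', euclNorm_sq']
  unfold dotProduct
  rw [Finset.mul_sum]
  refine Finset.sum_le_sum fun i _ => ?_
  rw [Matrix.mulVec_diagonal]
  have hp := Real.sqrt_pos.2 (hd i)
  have hi : (Real.sqrt (d i))⁻¹ ≤ ⨆ i, (Real.sqrt (d i))⁻¹ :=
    le_ciSup (f := fun i => (Real.sqrt (d i))⁻¹) (Set.finite_range _).bddAbove i
  have h1 : 1 ≤ (⨆ i, (Real.sqrt (d i))⁻¹) * Real.sqrt (d i) := by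
    rw [inv_le_iff_one_le_mul₀ hp] at hi
    exact hi
  have h2 : 1 ≤ ((⨆ i, (Real.sqrt (d i))⁻¹) * Real.sqrt (d i)) ^ 2 := one_le_pow₀ h1
  nlinarith [mul_le_mul_of_nonneg_right h2 (mul_self_nonneg (x i))]

lemma hasDeriv_energy {n : ℕ} (d : Fin n → ℝ) (hd : ∀ i, 0 < d i) (f : ℝ → Fin n → ℝ)
    (hf : ContDiff ℝ 1 f) (t : ℝ) :
    HasDerivAt (fun t => euclNorm ((Matrix.diagonal fun i => Real.sqrt (d i)).mulVec (f t)) ^ 2)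
      (2 * (f t ⬝ᵥ (Matrix.diagonal d).mulVec (deriv f t))) t := by
  have h1 : HasDerivAt f (deriv f t) t :=
    (hf.differentiable one_ne_zero).differentiableAt.hasDerivAt
  rw [hasDerivAt_pi] at h1
  have h2 : (fun t => euclNorm ((Matrix.diagonal fun i => Real.sqrt (d i)).mulVec (f t)) ^ 2)
      = fun t => ∑ i, d i * (f t i * f t i) := by
    funext s
    rw [euclNorm_sq']
    unfold dotProduct
    refine Finset.sum_congr rfl fun i _ => ?_
    rw [Matrix.mulVec_diagonal]
    nlinarith [Real.mul_self_sqrt (hd i).le]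
  rw [h2]
  have h3 := HasDerivAt.fun_sum (u := Finset.univ)
    fun i _ => (((h1 i).mul (h1 i)).const_mul (d i))
  refine h3.congr_deriv ?_
  symm
  unfold dotProduct
  rw [Finset.mul_sum]
  refine Finset.sum_congr rfl fun i _ => ?_
  rw [Matrix.mulVec_diagonal]
  ring

/-- The final displayed error estimate: at a time `t*` maximizing the weighted error norm
over `[0, t_f]`, the unweighted error norm is bounded by
`4 (max_i d_p(i)^{−1/2} + max_j d_q(j)^{−1/2})` times the time integral of the
inversely weighted residue norms. -/
theorem error_bound_unweighted (l m : ℕ) (d_p : Fin l → ℝ) (d_q : Fin m → ℝ)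
    (hdp : ∀ i, 0 < d_p i) (hdq : ∀ j, 0 < d_q j)
    (t_f : ℝ) (ht : 0 < t_f)
    (δe_p : ℝ → Fin l → ℝ) (δe_q : ℝ → Fin m → ℝ)
    (hc1 : ContDiff ℝ 1 δe_p) (hc2 : ContDiff ℝ 1 δe_q)
    (h0p : δe_p 0 = 0) (h0q : δe_q 0 = 0)
    (ρ_p : ℝ → Fin l → ℝ) (ρ_q : ℝ → Fin m → ℝ)
    (hρp : Continuous ρ_p) (hρq : Continuous ρ_q)
    (hbal : ∀ t ∈ Set.Icc (0 : ℝ) t_f,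
      δe_p t ⬝ᵥ (Matrix.diagonal d_p).mulVec (deriv δe_p t)
        + δe_q t ⬝ᵥ (Matrix.diagonal d_q).mulVec (deriv δe_q t)
      = -(δe_p t ⬝ᵥ ρ_p t) - δe_q t ⬝ᵥ ρ_q t)
    (tstar : ℝ) (htstar : tstar ∈ Set.Icc (0 : ℝ) t_f)
    (hmax : ∀ t ∈ Set.Icc (0 : ℝ) t_f,
      euclNorm ((Matrix.diagonal fun i => Real.sqrt (d_p i)).mulVec (δe_p t))
          + euclNorm ((Matrix.diagonal fun j => Real.sqrt (d_q j)).mulVec (δe_q t))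
        ≤ euclNorm ((Matrix.diagonal fun i => Real.sqrt (d_p i)).mulVec (δe_p tstar))
          + euclNorm ((Matrix.diagonal fun j => Real.sqrt (d_q j)).mulVec (δe_q tstar))) :
    euclNorm (δe_p tstar) + euclNorm (δe_q tstar)
    ≤ 4 * ((⨆ i, (Real.sqrt (d_p i))⁻¹) + (⨆ j, (Real.sqrt (d_q j))⁻¹))
        * ∫ τ in (0 : ℝ)..t_f,
            (euclNorm ((Matrix.diagonal fun i => (Real.sqrt (d_p i))⁻¹).mulVec (ρ_p τ))
              + euclNorm ((Matrix.diagonal fun j => (Real.sqrt (d_q j))⁻¹).mulVec (ρ_q τ))) := by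
  set P : ℝ → ℝ := fun t => euclNorm ((Matrix.diagonal fun i => Real.sqrt (d_p i)).mulVec (δe_p t))
    with hP
  set Q : ℝ → ℝ := fun t => euclNorm ((Matrix.diagonal fun i => Real.sqrt (d_q i)).mulVec (δe_q t))
    with hQ
  set a : ℝ → ℝ := fun τ =>
    euclNorm ((Matrix.diagonal fun i => (Real.sqrt (d_p i))⁻¹).mulVec (ρ_p τ)) with ha
  set b : ℝ → ℝ := fun τ =>
    euclNorm ((Matrix.diagonal fun i => (Real.sqrt (d_q i))⁻¹).mulVec (ρ_q τ)) with hb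
  change euclNorm (δe_p tstar) + euclNorm (δe_q tstar)
    ≤ 4 * ((⨆ i, (Real.sqrt (d_p i))⁻¹) + (⨆ j, (Real.sqrt (d_q j))⁻¹))
        * ∫ τ in (0 : ℝ)..t_f, (a τ + b τ)
  have hmax' : ∀ t ∈ Set.Icc (0 : ℝ) t_f, P t + Q t ≤ P tstar + Q tstar := hmax
  have hP0 : ∀ t, 0 ≤ P t := fun t => euclNorm_nonneg' _
  have hQ0 : ∀ t, 0 ≤ Q t := fun t => euclNorm_nonneg' _
  have ha0 : ∀ t, 0 ≤ a t := fun t => euclNorm_nonneg' _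
  have hb0 : ∀ t, 0 ≤ b t := fun t => euclNorm_nonneg' _
  have hac : Continuous a := euclNorm_cont.comp (Continuous.matrix_mulVec continuous_const hρp)
  have hbc : Continuous b := euclNorm_cont.comp (Continuous.matrix_mulVec continuous_const hρq)
  have hab : Continuous fun τ => a τ + b τ := hac.add hbc
  have hder : ∀ t, HasDerivAt (fun t => P t ^ 2 + Q t ^ 2)
      (2 * (δe_p t ⬝ᵥ (Matrix.diagonal d_p).mulVec (deriv δe_p t))
        + 2 * (δe_q t ⬝ᵥ (Matrix.diagonal d_q).mulVec (deriv δe_q t))) t := fun t =>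
    (hasDeriv_energy d_p hdp δe_p hc1 t).add (hasDeriv_energy d_q hdq δe_q hc2 t)
  have hdc1 : Continuous (deriv δe_p) := hc1.continuous_deriv le_rfl
  have hdc2 : Continuous (deriv δe_q) := hc2.continuous_deriv le_rfl
  have hcont : Continuous fun t => (2 * (δe_p t ⬝ᵥ (Matrix.diagonal d_p).mulVec (deriv δe_p t))
        + 2 * (δe_q t ⬝ᵥ (Matrix.diagonal d_q).mulVec (deriv δe_q t))) := by
    have e1 := hc1.continuous.dotProduct
      (Continuous.matrix_mulVec (continuous_const (y := Matrix.diagonal d_p)) hdc1)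
    have e2 := hc2.continuous.dotProduct
      (Continuous.matrix_mulVec (continuous_const (y := Matrix.diagonal d_q)) hdc2)
    exact (continuous_const.mul e1).add (continuous_const.mul e2)
  have hftc := intervalIntegral.integral_eq_sub_of_hasDerivAt (a := 0) (b := tstar)
    (fun t _ => hder t) (hcont.intervalIntegrable _ _)
  have hPz : P 0 = 0 := by simp [hP, h0p, euclNorm]
  have hQz : Q 0 = 0 := by simp [hQ, h0q, euclNorm]
  set S := P tstar + Q tstar with hS
  have hS0 : 0 ≤ S := add_nonneg (hP0 _) (hQ0 _)
  have hint2 : IntervalIntegrable (fun τ => (2 * S) * (a τ + b τ))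
      MeasureTheory.volume 0 tstar :=
    (continuous_const.mul hab).intervalIntegrable 0 tstar
  have hmono := intervalIntegral.integral_mono_on htstar.1
    (hcont.intervalIntegrable 0 tstar)
    hint2
    (fun t htt => by
      have htI : t ∈ Set.Icc (0 : ℝ) t_f := ⟨htt.1, htt.2.trans htstar.2⟩
      have k1 := hbal t htI
      have k2 : -(δe_p t ⬝ᵥ ρ_p t) ≤ P t * a t := neg_dot_le d_p hdp _ _
      have k3 : -(δe_q t ⬝ᵥ ρ_q t) ≤ Q t * b t := neg_dot_le d_q hdq _ _
      have k4 := hmax' t htI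
      have k5 : P t * a t ≤ S * a t :=
        mul_le_mul_of_nonneg_right (by linarith [hQ0 t]) (ha0 t)
      have k6 : Q t * b t ≤ S * b t :=
        mul_le_mul_of_nonneg_right (by linarith [hP0 t]) (hb0 t)
      linarith)
  rw [hftc, intervalIntegral.integral_const_mul, hPz, hQz] at hmono
  have hext : ∫ τ in (0 : ℝ)..tstar, (a τ + b τ) ≤ ∫ τ in (0 : ℝ)..t_f, (a τ + b τ) :=
    intervalIntegral.integral_mono_interval le_rfl htstar.1 htstar.2
      (Filter.Eventually.of_forall fun t => add_nonneg (ha0 t) (hb0 t))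
      (hab.intervalIntegrable _ _)
  set I := ∫ τ in (0 : ℝ)..t_f, (a τ + b τ) with hI
  have hI0 : 0 ≤ I := intervalIntegral.integral_nonneg ht.le
    fun t _ => add_nonneg (ha0 t) (hb0 t)
  have hSI : S ≤ 4 * I := by
    have j1 := mul_le_mul_of_nonneg_left hext (by linarith : 0 ≤ 2 * S)
    have j2 : S ^ 2 ≤ 2 * (P tstar ^ 2 + Q tstar ^ 2) := by
      rw [hS]; nlinarith [sq_nonneg (P tstar - Q tstar)]
    have j3 : S * S ≤ S * (4 * I) := by nlinarith
    rcases hS0.eq_or_lt with h | h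
    · linarith
    · exact le_of_mul_le_mul_left j3 h
  have hcp : 0 ≤ ⨆ i, (Real.sqrt (d_p i))⁻¹ := Real.iSup_nonneg fun i => by positivity
  have hcq : 0 ≤ ⨆ i, (Real.sqrt (d_q i))⁻¹ := Real.iSup_nonneg fun i => by positivity
  have f1 : euclNorm (δe_p tstar) ≤ (⨆ i, (Real.sqrt (d_p i))⁻¹) * P tstar :=
    euclNorm_le_weighted d_p hdp _
  have f2 : euclNorm (δe_q tstar) ≤ (⨆ i, (Real.sqrt (d_q i))⁻¹) * Q tstar :=
    euclNorm_le_weighted d_q hdq _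
  have f3 := mul_le_mul_of_nonneg_left hSI (add_nonneg hcp hcq)
  have f4 := mul_nonneg hcp (hQ0 tstar)
  have f5 := mul_nonneg hcq (hP0 tstar)
  rw [hS] at f3
  nlinarith
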